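/- Let J₁₅(x,y) = −1 + 2·Re(j₁₅(x+iy, x−iy)) with j₁₅(u,v) = (50−125b)u³ − (15+125b)u⁶ − 75b·u⁹ − 15b·u¹² − b·u¹⁵ + (75/2)uv − (225−750b)u⁴v + (15+525b)u⁷v + 165b·u¹⁰v + 15b·u¹³v − 225u²v² + (315−1575b)u⁵v² − 675b·u⁸v² − 90b·u¹¹v² + 525u³v³ − (140−1400b)u⁶v³ + 275b·u⁹v³ − 525u⁴v⁴ − 450b·u⁷v⁴ + 189u⁵v⁵, b = exp(−iπ/3), and let f : ℝ⁴ → ℝ be f(x₀,x₁,x₂,x₃) = J₁₅(x₀,x₁) − J₁₅(x₂,x₃). Then the set {p ∈ ℝ⁴ : f(p) = 0 and ∇f(p) = 0} consists of exactly 15646 points, and at each of these points the Hessian matrix of f is invertible; i.e. the affine three-fold f = 0 has exactly 15646 real nodes (A₁-singularities). -/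

import Mathlib

noncomputable section

/-- `bC = exp(-iπ/3)`. -/
def bC : ℂ := Complex.exp (-((Real.pi : ℂ) / 3) * Complex.I)

/-- The polynomial `j15(u,v)`. -/
def j15 (u v : ℂ) : ℂ := (50 - 125*bC)*u^3 - (15 + 125*bC)*u^6 - 75*bC*u^9 - 15*bC*u^12 - bC*u^15 + (75/2)*u*v - (225 - 750*bC)*u^4*v + (15 + 525*bC)*u^7*v + 165*bC*u^10*v + 15*bC*u^13*v - 225*u^2*v^2 + (315 - 1575*bC)*u^5*v^2 - 675*bC*u^8*v^2 - 90*bC*u^11*v^2 + 525*u^3*v^3 - (140 - 1400*bC)*u^6*v^3 + 275*bC*u^9*v^3 - 525*u^4*v^4 - 450*bC*u^7*v^4 + 189*u^5*v^5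

/-- The real folding-type polynomial `J15(x,y) = -1 + 2 Re(j15(x+iy, x-iy))`. -/
def J15R (x y : ℝ) : ℝ :=
  -1 + 2 * (j15 ((x : ℂ) + (y : ℂ) * Complex.I) ((x : ℂ) - (y : ℂ) * Complex.I)).re

/-- Partial derivative of `f` in the `i`-th coordinate direction. -/
def pd {n : ℕ} (i : Fin n) (f : (Fin n → ℝ) → ℝ) (x : Fin n → ℝ) : ℝ :=
  deriv (fun t => f (Function.update x i t)) (x i)

/-- Hessian matrix of `f` at `x`. -/
def hessian {n : ℕ} (f : (Fin n → ℝ) → ℝ) (x : Fin n → ℝ) : Matrix (Fin n) (Fin n) ℝ :=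
  Matrix.of fun i j => pd i (pd j f) x


namespace Nodes
open Complex (I)

/-- The `A₂` Chebyshev polynomial: the power sum `x₁^15 + x₂^15 + x₃^15` in terms of `e₁ = u`,
`e₂ = v`, `e₃ = 1`. -/
def P15 (u v : ℂ) : ℂ :=
  3 - 50*v^3 + 15*v^6 - 75*u*v + 225*u*v^4 - 15*u*v^7 + 450*u^2*v^2 - 315*u^2*v^5 + 75*u^3
    - 1050*u^3*v^3 + 140*u^3*v^6 - 525*u^4*v + 1050*u^4*v^4 + 1260*u^5*v^2 - 378*u^5*v^5
    + 140*u^6 - 1260*u^6*v^3 - 540*u^7*v + 450*u^7*v^4 + 675*u^8*v^2 + 75*u^9 - 275*u^9*v^3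
    - 165*u^10*v + 90*u^11*v^2 + 15*u^12 - 15*u^13*v + u^15

theorem P15_of_rec (u v : ℂ) (s : ℕ → ℂ) (h0 : s 0 = 3) (h1 : s 1 = u)
    (h2 : s 2 = u^2 - 2*v) (h : ∀ n, s (n+3) = u * s (n+2) - v * s (n+1) + s n) :
    s 15 = P15 u v := by
  have h3 := h 0
  have h4 := h 1
  have h5 := h 2
  have h6 := h 3
  have h7 := h 4
  have h8 := h 5
  have h9 := h 6
  have h10 := h 7
  have h11 := h 8
  have h12 := h 9
  have h13 := h 10
  have h14 := h 11
  have h15 := h 12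
  norm_num only at h3 h4 h5 h6 h7 h8 h9 h10 h11 h12 h13 h14 h15
  rw [h2, h1, h0] at h3
  rw [h3, h2, h1] at h4
  rw [h4, h3, h2] at h5
  ring_nf at h3 h4 h5
  rw [h5, h4, h3] at h6
  ring_nf at h6
  rw [h6, h5, h4] at h7
  ring_nf at h7
  rw [h7, h6, h5] at h8
  ring_nf at h8
  rw [h8, h7, h6] at h9
  ring_nf at h9
  rw [h9, h8, h7] at h10
  ring_nf at h10
  rw [h10, h9, h8] at h11
  ring_nf at h11
  rw [h11, h10, h9] at h12
  ring_nf at h12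
  rw [h12, h11, h10] at h13
  ring_nf at h13
  rw [h13, h12, h11] at h14
  ring_nf at h14
  rw [h14, h13, h12] at h15
  rw [h15, P15]
  ring

theorem P15_pow (a b c : ℂ) (h : a * b * c = 1) :
    P15 (a + b + c) (a*b + b*c + c*a) = a^15 + b^15 + c^15 := by
  symm
  refine P15_of_rec _ _ (fun n => a^n + b^n + c^n) ?_ ?_ ?_ ?_
  · norm_num
  · simp
  · ring
  · intro n
    linear_combination (a^n + b^n + c^n) * h

theorem bC_eq : bC = 1/2 - (Real.sqrt 3 / 2 : ℝ) * I := by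
  have : bC = Complex.exp ((-(Real.pi/3) : ℝ) * I) := by
    unfold bC; push_cast; rfl
  rw [this, Complex.exp_mul_I, ← Complex.ofReal_cos, ← Complex.ofReal_sin, Real.cos_neg,
    Real.sin_neg, Real.cos_pi_div_three, Real.sin_pi_div_three]
  push_cast; ring

theorem conj_bC : (starRingEnd ℂ) bC = 1 - bC := by
  rw [bC_eq]
  simp only [map_sub, map_mul, Complex.conj_ofReal, Complex.conj_I, map_div₀, map_one, map_ofNat]
  ring

theorem J_eq (x y : ℝ) (u v : ℂ) (hu : u = x + y * I) (hv : v = x - y * I) :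
    ((J15R x y : ℝ) : ℂ) = 2 - bC * P15 u v - (1 - bC) * P15 v u := by
  have hcu : (starRingEnd ℂ) u = v := by
    rw [hu, hv]; simp [sub_eq_add_neg]
  have hcv : (starRingEnd ℂ) v = u := by
    rw [hu, hv]; simp [sub_eq_add_neg]
  have h : ((J15R x y : ℝ) : ℂ) = -1 + (j15 u v + (starRingEnd ℂ) (j15 u v)) := by
    rw [Complex.add_conj, J15R, ← hu, ← hv]; push_cast; ring
  rw [h]
  unfold j15
  simp only [map_sub, map_add, map_mul, map_pow, map_div₀, map_ofNat, hcu, hcv, conj_bC]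
  unfold P15
  ring

/-- rotation factor -/
theorem neg_bC : -bC = Complex.exp ((2 * Real.pi / 3 : ℝ) * I) := by
  have : (((2 * Real.pi / 3 : ℝ) : ℂ)) * I = Real.pi * I + (-((Real.pi : ℂ) / 3) * I) := by
    push_cast; ring
  rw [this, Complex.exp_add, Complex.exp_pi_mul_I, bC]; ring

theorem neg_bC' : -(1 - bC) = Complex.exp (-(2 * Real.pi / 3 : ℝ) * I) := by
  rw [← conj_bC, ← map_neg, neg_bC, ← Complex.exp_conj, map_mul, Complex.conj_ofReal,
    Complex.conj_I]
  congr 1; ring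

theorem two_cos (θ : ℝ) : (2 * (Real.cos θ : ℂ)) = Complex.exp (θ * I) + Complex.exp (-θ * I) := by
  rw [Complex.ofReal_cos, Complex.cos]; ring

theorem cosfac (θ : ℝ) : (2 * (Real.cos (15*θ + 2*Real.pi/3) : ℂ))
    = -bC * Complex.exp (θ * I)^15 - (1-bC) * Complex.exp (-θ * I)^15 := by
  rw [two_cos, sub_eq_add_neg, ← neg_mul, neg_bC, neg_bC', ← Complex.exp_nat_mul,
    ← Complex.exp_nat_mul, ← Complex.exp_add, ← Complex.exp_add]
  congr 2 <;> (push_cast; ring)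

theorem J_torus (α β : ℝ) :
    J15R (Real.cos α + Real.cos β + Real.cos (α + β)) (Real.sin α + Real.sin β - Real.sin (α + β))
     = 2 + 2 * (Real.cos (15*α + 2*Real.pi/3) + Real.cos (15*β+2*Real.pi/3)
        + Real.cos (15*(-(α+β)) + 2*Real.pi/3)) := by
  have key : ∀ α : ℝ, Complex.exp (α * I) = Real.cos α + Real.sin α * I := by
    intro α; rw [Complex.exp_mul_I]; simp
  have key' : ∀ α : ℝ, Complex.exp (-α * I) = Real.cos α - Real.sin α * I := by
    intro α; rw [Complex.exp_mul_I]; simp [sub_eq_add_neg]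
  have hinv : ∀ α : ℝ, Complex.exp (α * I) * Complex.exp (-α * I) = 1 := by
    intro α; rw [← Complex.exp_add]; simp
  set a := Complex.exp (α * I) with ha
  set a' := Complex.exp (-α * I) with ha'
  set b := Complex.exp (β * I) with hb
  set b' := Complex.exp (-β * I) with hb'
  have haa := hinv α
  have hbb := hinv β
  rw [← ha, ← ha'] at haa
  rw [← hb, ← hb'] at hbb
  have hc : Complex.exp ((-(α+β) : ℝ) * I) = a' * b' := by
    rw [ha', hb', ← Complex.exp_add]; congr 1; push_cast; ring
  have hc' : Complex.exp (-(-(α+β) : ℝ) * I) = a * b := by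
    rw [ha, hb, ← Complex.exp_add]; congr 1; push_cast; ring
  have hP : a^15 + b^15 + (a'*b')^15 = P15 (a + b + a'*b') (a' + b' + a*b) := by
    rw [← P15_pow a b (a'*b') (by linear_combination b*b'*haa + hbb)]
    congr 1
    linear_combination b'*haa + a'*hbb
  have hP' : a'^15 + b'^15 + (a*b)^15 = P15 (a' + b' + a*b) (a + b + a'*b') := by
    rw [← P15_pow a' b' (a*b) (by linear_combination b*b'*haa + hbb)]
    congr 1
    linear_combination b*haa + a*hbb
  have := J_eq (u := a + b + a'*b') (v := a' + b' + a*b)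
    (x := Real.cos α + Real.cos β + Real.cos (α + β))
    (y := Real.sin α + Real.sin β - Real.sin (α + β)) (by
      rw [ha, hb, ← hc, key, key, key, Real.cos_neg, Real.sin_neg]; push_cast; ring) (by
      rw [ha', hb', ← hc', key', key', key', Real.cos_neg, Real.sin_neg]; push_cast; ring)
  have h1 := cosfac α
  have h2 := cosfac β
  have h3 := cosfac (-(α+β))
  rw [hc, hc'] at h3
  rw [← ha, ← ha'] at h1
  rw [← hb, ← hb'] at h2
  rw [← Complex.ofReal_inj, this, ← hP, ← hP']
  rw [Complex.ofReal_add, Complex.ofReal_mul, Complex.ofReal_add, Complex.ofReal_add]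
  rw [Complex.ofReal_ofNat]
  linear_combination - h1 - h2 - h3

/-- `r^15 + r^{-15}` as a polynomial in `t = r + 1/r`. -/
def C15 (t : ℝ) : ℝ := t^15 - 15*t^13 + 90*t^11 - 275*t^9 + 450*t^7 - 378*t^5 + 140*t^3 - 15*t

theorem J_tan (β t : ℝ) :
    J15R (Real.cos (2*β) + t * Real.cos β) (-Real.sin (2*β) + t * Real.sin β)
     = 2 + 2 * Real.cos (15*(-(2*β)) + 2*Real.pi/3) + 2 * (C15 t * Real.cos (15*β+2*Real.pi/3)) := by
  have key : ∀ α : ℝ, Complex.exp (α * I) = Real.cos α + Real.sin α * I := by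
    intro α; rw [Complex.exp_mul_I]; simp
  have key' : ∀ α : ℝ, Complex.exp (-α * I) = Real.cos α - Real.sin α * I := by
    intro α; rw [Complex.exp_mul_I]; simp [sub_eq_add_neg]
  have hinv : ∀ α : ℝ, Complex.exp (α * I) * Complex.exp (-α * I) = 1 := by
    intro α; rw [← Complex.exp_add]; simp
  obtain ⟨r, r', hr, hrr⟩ : ∃ r r' : ℂ, r + r' = t ∧ r * r' = 1 := by
    obtain ⟨w, hw⟩ := IsAlgClosed.exists_pow_nat_eq ((t : ℂ)^2 - 4) (n := 2) (by norm_num)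
    exact ⟨(t + w)/2, (t - w)/2, by ring, by linear_combination (-1/4)*hw⟩
  have hC : (C15 t : ℂ) = r^15 + r'^15 := by
    have : (C15 t : ℂ) = (t:ℂ)^15 - 15*t^13 + 90*t^11 - 275*t^9 + 450*t^7 - 378*t^5 + 140*t^3
        - 15*t := by
      rw [C15]; push_cast; ring
    have h2 : r^15 + r'^15 = (r+r')^15 - 15*(r+r')^13*(r*r') + 90*(r+r')^11*(r*r')^2
       - 275*(r+r')^9*(r*r')^3 + 450*(r+r')^7*(r*r')^4 - 378*(r+r')^5*(r*r')^5
       + 140*(r+r')^3*(r*r')^6 - 15*(r+r')*(r*r')^7 := by ring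
    rw [this, h2, hr, hrr]; ring
  set a := Complex.exp (β * I) with ha
  set a' := Complex.exp (-β * I) with ha'
  have haa := hinv β
  rw [← ha, ← ha'] at haa
  have hc : Complex.exp ((-(2*β) : ℝ) * I) = a'^2 := by
    rw [ha', ← Complex.exp_nat_mul]; congr 1; push_cast; ring
  have hc' : Complex.exp (-(-(2*β) : ℝ) * I) = a^2 := by
    rw [ha, ← Complex.exp_nat_mul]; congr 1; push_cast; ring
  have hP : (a'^2)^15 + (r*a)^15 + (r'*a)^15 = P15 (a'^2 + t*a) (a^2 + t*a') := by
    rw [← P15_pow (a'^2) (r*a) (r'*a) (by linear_combination (a^2*a'^2)*hrr + (a*a'+1)*haa), ← hr]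
    congr 1
    · ring
    · linear_combination a^2*hrr + a'*(r+r')*haa
  have hP' : (a^2)^15 + (r*a')^15 + (r'*a')^15 = P15 (a^2 + t*a') (a'^2 + t*a) := by
    rw [← P15_pow (a^2) (r*a') (r'*a') (by linear_combination (a^2*a'^2)*hrr + (a*a'+1)*haa), ← hr]
    congr 1
    · ring
    · linear_combination a'^2*hrr + a*(r+r')*haa
  have := J_eq (u := a'^2 + t*a) (v := a^2 + t*a')
    (x := Real.cos (2*β) + t * Real.cos β)
    (y := -Real.sin (2*β) + t * Real.sin β) (by
      rw [ha, ← hc, key, key, Real.cos_neg, Real.sin_neg]; push_cast; ring) (by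
      rw [ha', ← hc', key', key', Real.cos_neg, Real.sin_neg]; push_cast; ring)
  have h1 := cosfac β
  have h3 := cosfac (-(2*β))
  rw [hc, hc'] at h3
  rw [← ha, ← ha'] at h1
  rw [← Complex.ofReal_inj, this, ← hP, ← hP']
  simp only [Complex.ofReal_add, Complex.ofReal_mul (2:ℝ), Complex.ofReal_mul (C15 t),
    Complex.ofReal_ofNat]
  rw [hC]
  linear_combination - (r^15+r'^15)*h1 - h3

end Nodes

namespace Nodes
open Complex (I)
open scoped ContDiff

def F (p : ℝ × ℝ) : ℝ := J15R p.1 p.2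

theorem j15_contDiff {u v : ℝ × ℝ → ℂ} (hu : ContDiff ℝ ∞ u) (hv : ContDiff ℝ ∞ v) :
    ContDiff ℝ ∞ (fun p => j15 (u p) (v p)) := by
  unfold j15
  fun_prop

theorem F_contDiff : ContDiff ℝ ∞ F := by
  have hre : ContDiff ℝ ∞ (fun z : ℂ => z.re) := Complex.reCLM.contDiff
  have hof : ContDiff ℝ ∞ (fun z : ℝ => (z : ℂ)) := Complex.ofRealCLM.contDiff
  have hx : ContDiff ℝ ∞ (fun p : ℝ × ℝ => (p.1 : ℂ)) := hof.comp contDiff_fst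
  have hy : ContDiff ℝ ∞ (fun p : ℝ × ℝ => (p.2 : ℂ)) := hof.comp contDiff_snd
  have hu : ContDiff ℝ ∞ (fun p : ℝ × ℝ => (p.1 : ℂ) + (p.2 : ℂ) * I) :=
    hx.add (hy.mul contDiff_const)
  have hv : ContDiff ℝ ∞ (fun p : ℝ × ℝ => (p.1 : ℂ) - (p.2 : ℂ) * I) :=
    hx.sub (hy.mul contDiff_const)
  have hj : ContDiff ℝ ∞ (fun p : ℝ × ℝ => j15 ((p.1 : ℂ) + (p.2 : ℂ) * I)
      ((p.1 : ℂ) - (p.2 : ℂ) * I)) := j15_contDiff hu hv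
  unfold F J15R
  exact contDiff_const.add (contDiff_const.mul (hre.comp hj))

def dx (A : ℝ × ℝ → ℝ) (p : ℝ × ℝ) : ℝ := fderiv ℝ A p (1, 0)
def dy (A : ℝ × ℝ → ℝ) (p : ℝ × ℝ) : ℝ := fderiv ℝ A p (0, 1)

theorem dx_contDiff {A : ℝ × ℝ → ℝ} (h : ContDiff ℝ ∞ A) : ContDiff ℝ ∞ (dx A) := by
  unfold dx
  exact (h.fderiv_right (m := ∞) (by simp)).clm_apply contDiff_const

theorem dy_contDiff {A : ℝ × ℝ → ℝ} (h : ContDiff ℝ ∞ A) : ContDiff ℝ ∞ (dy A) := by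
  unfold dy
  exact (h.fderiv_right (m := ∞) (by simp)).clm_apply contDiff_const

theorem chain {A : ℝ × ℝ → ℝ} (h : ContDiff ℝ ∞ A) {X Y : ℝ → ℝ} {X' Y' s : ℝ}
    (hX : HasDerivAt X X' s) (hY : HasDerivAt Y Y' s) :
    HasDerivAt (fun s => A (X s, Y s)) (dx A (X s, Y s) * X' + dy A (X s, Y s) * Y') s := by
  have h1 : HasFDerivAt A (fderiv ℝ A (X s, Y s)) (X s, Y s) :=
    ((h.differentiable (by simp)) _).hasFDerivAt
  have h2 := h1.comp_hasDerivAt s (hX.prodMk hY)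
  refine h2.congr_deriv ?_
  have : ((X', Y') : ℝ × ℝ) = X' • ((1, 0) : ℝ × ℝ) + Y' • ((0, 1) : ℝ × ℝ) := by
    ext <;> simp
  rw [this, map_add, map_smul, map_smul, dx, dy]
  simp [mul_comm]

theorem pd_split {A B : ℝ × ℝ → ℝ} (hA : ContDiff ℝ ∞ A) (hB : ContDiff ℝ ∞ B)
    (H : (Fin 4 → ℝ) → ℝ) (hH : ∀ p, H p = A (p 0, p 1) + B (p 2, p 3)) (p : Fin 4 → ℝ) :
    pd 0 H p = dx A (p 0, p 1) ∧ pd 1 H p = dy A (p 0, p 1) ∧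
    pd 2 H p = dx B (p 2, p 3) ∧ pd 3 H p = dy B (p 2, p 3) := by
  have c : ∀ (a s : ℝ), HasDerivAt (fun _ : ℝ => a) 0 s := fun a s => hasDerivAt_const s a
  have e : ∀ (s : ℝ), HasDerivAt (fun s : ℝ => s) 1 s := fun s => hasDerivAt_id s
  refine ⟨?_, ?_, ?_, ?_⟩
  · have := (chain hA (e (p 0)) (c (p 1) (p 0))).add_const (B (p 2, p 3))
    unfold pd
    rw [show (fun t => H (Function.update p 0 t)) = fun t => A (t, p 1) + B (p 2, p 3) by
      funext t; rw [hH]; simp]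
    rw [this.deriv]; simp
  · have := (chain hA (c (p 0) (p 1)) (e (p 1))).add_const (B (p 2, p 3))
    unfold pd
    rw [show (fun t => H (Function.update p 1 t)) = fun t => A (p 0, t) + B (p 2, p 3) by
      funext t; rw [hH]; simp]
    rw [this.deriv]; simp
  · have := (chain hB (e (p 2)) (c (p 3) (p 2))).const_add (A (p 0, p 1))
    unfold pd
    rw [show (fun t => H (Function.update p 2 t)) = fun t => A (p 0, p 1) + B (t, p 3) by
      funext t; rw [hH]; simp]
    rw [this.deriv]; simp
  · have := (chain hB (c (p 2) (p 3)) (e (p 3))).const_add (A (p 0, p 1))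
    unfold pd
    rw [show (fun t => H (Function.update p 3 t)) = fun t => A (p 0, p 1) + B (p 2, t) by
      funext t; rw [hH]; simp]
    rw [this.deriv]; simp

def IsCrit (p : ℝ × ℝ) : Prop := dx F p = 0 ∧ dy F p = 0

def hdet (p : ℝ × ℝ) : ℝ := dx (dx F) p * dy (dy F) p - dy (dx F) p * dx (dy F) p

theorem dx_neg (A : ℝ × ℝ → ℝ) (p) : dx (fun q => - A q) p = - dx A p := by
  simp [dx]
theorem dy_neg (A : ℝ × ℝ → ℝ) (p) : dy (fun q => - A q) p = - dy A p := by
  simp [dy]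
theorem dx_zero (p) : dx (fun _ => 0) p = 0 := by
  simp [dx]
theorem dy_zero (p) : dy (fun _ => 0) p = 0 := by
  simp [dy]

theorem pd_f (f : (Fin 4 → ℝ) → ℝ)
    (hf : ∀ p, f p = J15R (p 0) (p 1) - J15R (p 2) (p 3)) (p : Fin 4 → ℝ) :
    pd 0 f p = dx F (p 0, p 1) ∧ pd 1 f p = dy F (p 0, p 1) ∧
    pd 2 f p = -dx F (p 2, p 3) ∧ pd 3 f p = -dy F (p 2, p 3) := by
  have := pd_split F_contDiff F_contDiff.neg f (fun p => by rw [hf]; simp [F, sub_eq_add_neg]) p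
  rw [dx_neg, dy_neg] at this
  exact this

theorem crit_iff (f : (Fin 4 → ℝ) → ℝ)
    (hf : ∀ p, f p = J15R (p 0) (p 1) - J15R (p 2) (p 3)) (p : Fin 4 → ℝ) :
    (∀ i, pd i f p = 0) ↔ IsCrit (p 0, p 1) ∧ IsCrit (p 2, p 3) := by
  obtain ⟨h0, h1, h2, h3⟩ := pd_f f hf p
  rw [Fin.forall_fin_succ, Fin.forall_fin_succ, Fin.forall_fin_succ, Fin.forall_fin_succ]
  simp [h0, h1, h2, h3, IsCrit, and_assoc]

theorem det_hess (f : (Fin 4 → ℝ) → ℝ)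
    (hf : ∀ p, f p = J15R (p 0) (p 1) - J15R (p 2) (p 3)) (p : Fin 4 → ℝ) :
    (hessian f p).det = hdet (p 0, p 1) * hdet (p 2, p 3) := by
  have hx := dx_contDiff F_contDiff
  have hy := dy_contDiff F_contDiff
  have z : ContDiff ℝ ∞ (fun _ : ℝ × ℝ => (0 : ℝ)) := contDiff_const
  obtain ⟨a0, a1, a2, a3⟩ := pd_split hx z (pd 0 f) (fun p => by rw [(pd_f f hf p).1]; simp) p
  obtain ⟨b0, b1, b2, b3⟩ := pd_split hy z (pd 1 f) (fun p => by rw [(pd_f f hf p).2.1]; simp) p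
  obtain ⟨c0, c1, c2, c3⟩ := pd_split z hx.neg (pd 2 f)
    (fun p => by rw [(pd_f f hf p).2.2.1]; simp) p
  obtain ⟨d0, d1, d2, d3⟩ := pd_split z hy.neg (pd 3 f)
    (fun p => by rw [(pd_f f hf p).2.2.2]; simp) p
  rw [dx_zero] at a2 b2 c0 d0
  rw [dy_zero] at a3 b3 c1 d1
  rw [dx_neg] at c2 d2
  rw [dy_neg] at c3 d3
  have : hessian f p = !![dx (dx F) (p 0, p 1), dx (dy F) (p 0, p 1), 0, 0;
     dy (dx F) (p 0, p 1), dy (dy F) (p 0, p 1), 0, 0;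
     0, 0, -dx (dx F) (p 2, p 3), -dx (dy F) (p 2, p 3);
     0, 0, -dy (dx F) (p 2, p 3), -dy (dy F) (p 2, p 3)] := by
    ext i j
    unfold hessian
    rw [Matrix.of_apply]
    fin_cases i <;> fin_cases j <;> simp [a0, a1, a2, a3, b0, b1, b2, b3, c0, c1, c2, c3, d0, d1, d2, d3]
  rw [this, hdet, hdet]
  simp [Matrix.det_succ_row_zero, Fin.sum_univ_succ, Fin.succAbove]
  ring

end Nodes

namespace Nodes
open Complex (I)
open scoped ContDiff

/-- The quotient map from the torus to the deltoid. -/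
def Phi (α β : ℝ) : ℝ × ℝ :=
  (Real.cos α + Real.cos β + Real.cos (α + β), Real.sin α + Real.sin β - Real.sin (α + β))

def th : ℝ := 2 * Real.pi / 3

def Xa (α β : ℝ) : ℝ := -Real.sin α - Real.sin (α + β)
def Ya (α β : ℝ) : ℝ := Real.cos α - Real.cos (α + β)
def Xb (α β : ℝ) : ℝ := -Real.sin β - Real.sin (α + β)
def Yb (α β : ℝ) : ℝ := Real.cos β - Real.cos (α + β)
def ga (α β : ℝ) : ℝ := 30 * (Real.sin (15*(-(α+β)) + th) - Real.sin (15*α + th))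
def gb (α β : ℝ) : ℝ := 30 * (Real.sin (15*(-(α+β)) + th) - Real.sin (15*β + th))

theorem d_sin1 (k α c : ℝ) : HasDerivAt (fun s => Real.sin (k * s + c)) (k * Real.cos (k*α+c)) α := by
  have : HasDerivAt (fun s : ℝ => k * s + c) k α := by
    simpa using ((hasDerivAt_id α).const_mul k).add_const c
  exact this.sin.congr_deriv (mul_comm _ _)

theorem d_cos1 (k α c : ℝ) :
    HasDerivAt (fun s => Real.cos (k * s + c)) (-(k * Real.sin (k*α+c))) α := by
  have : HasDerivAt (fun s : ℝ => k * s + c) k α := by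
    simpa using ((hasDerivAt_id α).const_mul k).add_const c
  exact this.cos.congr_deriv (by ring)

theorem d_neg_a (α β c : ℝ) : HasDerivAt (fun s => 15 * (-(s + β)) + c) (-15) α := by
  simpa using (((hasDerivAt_id α).add_const β).neg.const_mul 15).add_const c

theorem d_neg_b (α β c : ℝ) : HasDerivAt (fun s => 15 * (-(α + s)) + c) (-15) β := by
  simpa using (((hasDerivAt_id β).const_add α).neg.const_mul 15).add_const c

theorem d_add_a (α β : ℝ) : HasDerivAt (fun s => s + β) 1 α := (hasDerivAt_id α).add_const β
theorem d_add_b (α β : ℝ) : HasDerivAt (fun s => α + s) 1 β := (hasDerivAt_id β).const_add α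

theorem dX_a (α β : ℝ) : HasDerivAt (fun s => (Phi s β).1) (Xa α β) α :=
  (((Real.hasDerivAt_cos α).add_const (Real.cos β)).add (d_add_a α β).cos).congr_deriv
    (by simp only [Xa]; ring)
theorem dX_b (α β : ℝ) : HasDerivAt (fun s => (Phi α s).1) (Xb α β) β :=
  (((Real.hasDerivAt_cos β).const_add (Real.cos α)).add (d_add_b α β).cos).congr_deriv
    (by simp only [Xb]; ring)
theorem dY_a (α β : ℝ) : HasDerivAt (fun s => (Phi s β).2) (Ya α β) α :=
  (((Real.hasDerivAt_sin α).add_const (Real.sin β)).sub (d_add_a α β).sin).congr_deriv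
    (by simp only [Ya]; ring)
theorem dY_b (α β : ℝ) : HasDerivAt (fun s => (Phi α s).2) (Yb α β) β :=
  (((Real.hasDerivAt_sin β).const_add (Real.sin α)).sub (d_add_b α β).sin).congr_deriv
    (by simp only [Yb]; ring)

theorem F_Phi (α β : ℝ) : F (Phi α β) = 2 + 2 * (Real.cos (15*α + th) + Real.cos (15*β + th)
        + Real.cos (15*(-(α+β)) + th)) := J_torus α β

theorem grad_a (α β : ℝ) :
    dx F (Phi α β) * Xa α β + dy F (Phi α β) * Ya α β = ga α β := by
  have h1 := chain F_contDiff (dX_a α β) (dY_a α β)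
  have h2 : HasDerivAt (fun s => 2 + 2 * (Real.cos (15*s + th) + Real.cos (15*β + th)
        + Real.cos (15*(-(s+β)) + th))) (ga α β) α :=
    (((((d_cos1 15 α th).add_const _).add (d_neg_a α β th).cos).const_mul 2).const_add
      2).congr_deriv (by simp only [ga]; ring)
  refine h1.unique (h2.congr_of_eventuallyEq (Filter.Eventually.of_forall fun s => ?_))
  exact F_Phi s β

theorem grad_b (α β : ℝ) :
    dx F (Phi α β) * Xb α β + dy F (Phi α β) * Yb α β = gb α β := by
  have h1 := chain F_contDiff (dX_b α β) (dY_b α β)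
  have h2 : HasDerivAt (fun s => 2 + 2 * (Real.cos (15*α + th) + Real.cos (15*s + th)
        + Real.cos (15*(-(α+s)) + th))) (gb α β) β :=
    (((((d_cos1 15 β th).const_add _).add (d_neg_b α β th).cos).const_mul 2).const_add
      2).congr_deriv (by simp only [gb]; ring)
  refine h1.unique (h2.congr_of_eventuallyEq (Filter.Eventually.of_forall fun s => ?_))
  exact F_Phi α s

def Dt (α β : ℝ) : ℝ := Xa α β * Yb α β - Xb α β * Ya α β

theorem sin_of_crit {α β : ℝ} (h : IsCrit (Phi α β)) :
    Real.sin (15*(-(α+β)) + th) = Real.sin (15*α + th) ∧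
    Real.sin (15*(-(α+β)) + th) = Real.sin (15*β + th) := by
  have h1 := grad_a α β
  have h2 := grad_b α β
  rw [h.1, h.2, ga] at h1
  rw [h.1, h.2, gb] at h2
  constructor <;> linarith

theorem crit_of_sin {α β : ℝ} (hD : Dt α β ≠ 0)
    (h1 : Real.sin (15*(-(α+β)) + th) = Real.sin (15*α + th))
    (h2 : Real.sin (15*(-(α+β)) + th) = Real.sin (15*β + th)) : IsCrit (Phi α β) := by
  have e1 := grad_a α β
  have e2 := grad_b α β
  rw [ga, h1, sub_self, mul_zero] at e1
  rw [gb, h2, sub_self, mul_zero] at e2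
  unfold Dt at hD
  constructor
  · apply (mul_eq_zero.mp _).resolve_right hD
    linear_combination Yb α β * e1 - Ya α β * e2
  · apply (mul_eq_zero.mp _).resolve_right hD
    linear_combination Xa α β * e2 - Xb α β * e1

theorem hdet_ne {α β : ℝ} (h : IsCrit (Phi α β))
    (hc : Real.cos (15*α + th) * Real.cos (15*β + th)
      + Real.cos (15*α + th) * Real.cos (15*(-(α+β)) + th)
      + Real.cos (15*β + th) * Real.cos (15*(-(α+β)) + th) ≠ 0) : hdet (Phi α β) ≠ 0 := by
  have hx := dx_contDiff F_contDiff
  have hy := dy_contDiff F_contDiff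
  have Xaa : HasDerivAt (fun s => Xa s β) (-Real.cos α - Real.cos (α+β)) α :=
    ((Real.hasDerivAt_sin α).neg.sub (d_add_a α β).sin).congr_deriv (by ring)
  have Xab : HasDerivAt (fun s => Xa α s) (- Real.cos (α+β)) β :=
    ((d_add_b α β).sin.const_sub (-Real.sin α)).congr_deriv (by ring)
  have Yaa : HasDerivAt (fun s => Ya s β) (-Real.sin α + Real.sin (α+β)) α :=
    ((Real.hasDerivAt_cos α).sub (d_add_a α β).cos).congr_deriv (by ring)
  have Yab : HasDerivAt (fun s => Ya α s) (Real.sin (α+β)) β :=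
    ((d_add_b α β).cos.const_sub (Real.cos α)).congr_deriv (by ring)
  have Xba : HasDerivAt (fun s => Xb s β) (- Real.cos (α+β)) α :=
    ((d_add_a α β).sin.const_sub (-Real.sin β)).congr_deriv (by ring)
  have Xbb : HasDerivAt (fun s => Xb α s) (-Real.cos β - Real.cos (α+β)) β :=
    ((Real.hasDerivAt_sin β).neg.sub (d_add_b α β).sin).congr_deriv (by ring)
  have Yba : HasDerivAt (fun s => Yb s β) (Real.sin (α+β)) α :=
    ((d_add_a α β).cos.const_sub (Real.cos β)).congr_deriv (by ring)
  have Ybb : HasDerivAt (fun s => Yb α s) (-Real.sin β + Real.sin (α+β)) β :=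
    ((Real.hasDerivAt_cos β).sub (d_add_b α β).cos).congr_deriv (by ring)
  set cA := Real.cos (15*α + th) with hcA
  set cB := Real.cos (15*β + th) with hcB
  set cC := Real.cos (15*(-(α+β)) + th) with hcC
  have gaa : HasDerivAt (fun s => ga s β) (-450 * (cC + cA)) α :=
    (((d_neg_a α β th).sin.sub (d_sin1 15 α th)).const_mul 30).congr_deriv (by rw [hcA, hcC]; ring)
  have gab : HasDerivAt (fun s => ga α s) (-450 * cC) β :=
    (((d_neg_b α β th).sin.sub_const _).const_mul 30).congr_deriv (by rw [hcC]; ring)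
  have gba : HasDerivAt (fun s => gb s β) (-450 * cC) α :=
    (((d_neg_a α β th).sin.sub_const _).const_mul 30).congr_deriv (by rw [hcC]; ring)
  have gbb : HasDerivAt (fun s => gb α s) (-450 * (cC + cB)) β :=
    (((d_neg_b α β th).sin.sub (d_sin1 15 β th)).const_mul 30).congr_deriv (by rw [hcB, hcC]; ring)
  have E1 := (((chain hx (dX_a α β) (dY_a α β)).mul Xaa).add
    ((chain hy (dX_a α β) (dY_a α β)).mul Yaa)).unique
      (gaa.congr_of_eventuallyEq (Filter.Eventually.of_forall fun s => grad_a s β))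
  have E2 := (((chain hx (dX_b α β) (dY_b α β)).mul Xab).add
    ((chain hy (dX_b α β) (dY_b α β)).mul Yab)).unique
      (gab.congr_of_eventuallyEq (Filter.Eventually.of_forall fun s => grad_a α s))
  have E3 := (((chain hx (dX_a α β) (dY_a α β)).mul Xba).add
    ((chain hy (dX_a α β) (dY_a α β)).mul Yba)).unique
      (gba.congr_of_eventuallyEq (Filter.Eventually.of_forall fun s => grad_b s β))
  have E4 := (((chain hx (dX_b α β) (dY_b α β)).mul Xbb).add
    ((chain hy (dX_b α β) (dY_b α β)).mul Ybb)).unique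
      (gbb.congr_of_eventuallyEq (Filter.Eventually.of_forall fun s => grad_b α s))
  simp only [Prod.mk.eta, h.1, h.2, zero_mul, add_zero] at E1 E2 E3 E4
  intro h0
  unfold hdet at h0
  apply hc
  have : (-450 * (cC + cA)) * (-450 * (cC + cB)) - (-450 * cC) * (-450 * cC) = 0 := by
    rw [← E1, ← E4]
    nth_rewrite 1 [← E2]
    rw [← E3]
    linear_combination (Xa α β * Yb α β - Xb α β * Ya α β)^2 * h0
  linear_combination (1/450^2) * this

theorem Dt_ne {α β : ℝ}
    (h1 : Complex.exp (α * I) ≠ Complex.exp (β * I))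
    (h2 : Complex.exp (α * I) ≠ Complex.exp ((-(α+β) : ℝ) * I))
    (h3 : Complex.exp (β * I) ≠ Complex.exp ((-(α+β) : ℝ) * I)) : Dt α β ≠ 0 := by
  have hs : ∀ s : ℝ, I * (Real.sin s : ℂ) = (Complex.exp (s * I) - (Complex.exp (s * I))⁻¹) / 2 := by
    intro s
    rw [← Complex.exp_neg, ← neg_mul, Complex.ofReal_sin, Complex.sin]
    linear_combination ((Complex.exp (-s*I) - Complex.exp (s * I))/2) * Complex.I_sq
  have hcs : ∀ s : ℝ, (Real.cos s : ℂ) = (Complex.exp (s * I) + (Complex.exp (s * I))⁻¹) / 2 := by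
    intro s
    rw [← Complex.exp_neg, ← neg_mul, Complex.ofReal_cos, Complex.cos]
  have hab : Complex.exp ((α + β : ℝ) * I) = Complex.exp (α * I) * Complex.exp (β * I) := by
    rw [← Complex.exp_add]; congr 1; push_cast; ring
  have hc : Complex.exp ((-(α + β) : ℝ) * I) = (Complex.exp (α * I) * Complex.exp (β * I))⁻¹ := by
    rw [← hab, ← Complex.exp_neg]; congr 1; push_cast; ring
  rw [hc] at h2 h3
  have sa := hs α
  have sb := hs β
  have sc := hs (α + β)
  have ca := hcs α
  have cb := hcs β
  have cc := hcs (α + β)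
  rw [hab] at sc cc
  have na := Complex.exp_ne_zero (α * I)
  have nb := Complex.exp_ne_zero (β * I)
  set a := Complex.exp (α * I)
  set b := Complex.exp (β * I)
  have key : 2 * I * (Dt α β : ℂ) = (a - (a*b)⁻¹) * (b - (a*b)⁻¹) * (a - b) := by
    have e : 2 * I * (Dt α β : ℂ) = 2 * ((-(I * (Real.sin α : ℂ)) - I * (Real.sin (α+β) : ℂ)) *
      ((Real.cos β : ℂ) - (Real.cos (α+β) : ℂ)) - (-(I * (Real.sin β : ℂ)) - I * (Real.sin (α+β) : ℂ)) *
      ((Real.cos α : ℂ) - (Real.cos (α+β) : ℂ))) := by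
      simp only [Dt, Xa, Xb, Ya, Yb, Complex.ofReal_sub, Complex.ofReal_mul, Complex.ofReal_neg]
      ring
    rw [e, sa, sb, sc, ca, cb, cc]
    field_simp
    ring
  intro h0
  rw [h0, Complex.ofReal_zero, mul_zero] at key
  have := mul_ne_zero (mul_ne_zero (sub_ne_zero.mpr h2) (sub_ne_zero.mpr h3)) (sub_ne_zero.mpr h1)
  exact this key.symm

end Nodes

namespace Nodes
open Complex (I)
open scoped ContDiff

theorem not_crit_tan (β t : ℝ) (ht : 4 ≤ t^2) :
    ¬ IsCrit (Real.cos (2*β) + t * Real.cos β, -Real.sin (2*β) + t * Real.sin β) := by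
  intro h
  obtain ⟨q, hq, hq0⟩ : ∃ q, t^2 = 4 + q ∧ 0 ≤ q := ⟨t^2 - 4, by ring, by linarith⟩
  have ht0 : t ≠ 0 := by rintro rfl; norm_num at ht
  have hC : C15 t ≠ 0 := by
    have e : C15 t = t * ((t^2)^7 - 15*(t^2)^6 + 90*(t^2)^5 - 275*(t^2)^4 + 450*(t^2)^3
        - 378*(t^2)^2 + 140*(t^2) - 15) := by unfold C15; ring
    rw [e, hq]
    refine mul_ne_zero ht0 (ne_of_gt ?_)
    ring_nf
    positivity
  set C' : ℝ := 15*t^14 - 195*t^12 + 990*t^10 - 2475*t^8 + 3150*t^6 - 1890*t^4 + 420*t^2 - 15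
    with hC'
  have hC'0 : C' ≠ 0 := by
    have e : C' = 15*(t^2)^7 - 195*(t^2)^6 + 990*(t^2)^5 - 2475*(t^2)^4 + 3150*(t^2)^3
        - 1890*(t^2)^2 + 420*(t^2) - 15 := by rw [hC']; ring
    rw [e, hq]
    refine ne_of_gt ?_
    ring_nf
    positivity
  have dC : HasDerivAt C15 C' t := by
    have p : ∀ n : ℕ, HasDerivAt (fun x : ℝ => x^n) (n * t^(n-1)) t := fun n => hasDerivAt_pow n t
    refine ((((((((p 15).sub ((p 13).const_mul 15)).add ((p 11).const_mul 90)).sub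
      ((p 9).const_mul 275)).add ((p 7).const_mul 450)).sub ((p 5).const_mul 378)).add
      ((p 3).const_mul 140)).sub ((hasDerivAt_id t).const_mul 15)).congr_deriv ?_
    rw [hC']; norm_num; ring
  have hcos : Real.cos (15*β + th) = 0 := by
    have h1 := chain F_contDiff
      (((hasDerivAt_id t).mul_const (Real.cos β)).const_add (Real.cos (2*β)))
      (((hasDerivAt_id t).mul_const (Real.sin β)).const_add (-Real.sin (2*β)))
    have h2 : HasDerivAt (fun s => 2 + 2 * Real.cos (15*(-(2*β)) + 2*Real.pi/3)
        + 2 * (C15 s * Real.cos (15*β+2*Real.pi/3))) (2 * (C' * Real.cos (15*β+2*Real.pi/3))) t :=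
      ((dC.mul_const _).const_mul 2).const_add _
    have h3 := h1.unique (h2.congr_of_eventuallyEq
      (Filter.Eventually.of_forall fun s => J_tan β s))
    simp only [id] at h3
    rw [h.1, h.2] at h3
    have : C' * Real.cos (15*β+2*Real.pi/3) = 0 := by linarith
    exact (mul_eq_zero.mp this).resolve_left hC'0
  have hsin : Real.sin (15*β + th) = 0 := by
    have h1 := chain F_contDiff
      ((d_cos1 2 β 0).add ((Real.hasDerivAt_cos β).const_mul t))
      ((d_sin1 2 β 0).neg.add ((Real.hasDerivAt_sin β).const_mul t))
    have h2 : HasDerivAt (fun s => 2 + 2 * Real.cos ((-30)*s + 2*Real.pi/3)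
        + 2 * (C15 t * Real.cos (15*s+2*Real.pi/3))) _ β :=
      ((((d_cos1 (-30) β (2*Real.pi/3)).const_mul 2).const_add 2).add
        (((d_cos1 15 β (2*Real.pi/3)).const_mul (C15 t)).const_mul 2))
    have h3 := h1.unique (h2.congr_of_eventuallyEq
      (Filter.Eventually.of_forall fun s => by
        have := J_tan s t
        simp only [Pi.add_apply, Pi.neg_apply, add_zero, F]
        rw [this]; ring_nf))
    simp only [Pi.add_apply, Pi.neg_apply, add_zero] at h3
    rw [h.1, h.2] at h3
    have e : (-30) * β + 2*Real.pi/3 = 2 * Real.pi - 2 * (15 * β + th) := by unfold th; ring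
    rw [e, Real.sin_two_pi_sub, Real.sin_two_mul (15 * β + th), hcos] at h3
    have : C15 t * Real.sin (15*β + th) = 0 := by unfold th; linarith
    exact (mul_eq_zero.mp this).resolve_left hC
  have := Real.sin_sq_add_cos_sq (15*β + th)
  rw [hsin, hcos] at this
  norm_num at this

theorem exists_tan (x y : ℝ) : ∃ β t : ℝ, x = Real.cos (2*β) + t * Real.cos β ∧
    y = -Real.sin (2*β) + t * Real.sin β := by
  have hz : ∃ β : ℝ, (y + Real.sin (2*β)) * Real.cos β - (x - Real.cos (2*β)) * Real.sin β = 0 := by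
    set h : ℝ → ℝ := fun β => (y + Real.sin (2*β)) * Real.cos β - (x - Real.cos (2*β)) * Real.sin β
      with hh
    have hc : Continuous h := by rw [hh]; fun_prop
    have h0 : h 0 = y := by simp [hh]
    have hpi : h Real.pi = -y := by simp [hh]
    rcases le_total y 0 with hy | hy
    · exact mem_range_of_exists_le_of_exists_ge hc ⟨0, by linarith⟩ ⟨Real.pi, by linarith⟩
    · exact mem_range_of_exists_le_of_exists_ge hc ⟨Real.pi, by linarith⟩ ⟨0, by linarith⟩
  obtain ⟨β, hβ⟩ := hz
  refine ⟨β, (x - Real.cos (2*β)) * Real.cos β + (y + Real.sin (2*β)) * Real.sin β, ?_, ?_⟩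
  · linear_combination (-Real.sin β) * hβ - (x - Real.cos (2*β)) * Real.sin_sq_add_cos_sq β
  · linear_combination (Real.cos β) * hβ - (y + Real.sin (2*β)) * Real.sin_sq_add_cos_sq β

theorem exp_eq_imp {s t : ℝ} (h : Complex.exp (s * I) = Complex.exp (t * I)) :
    Real.cos s = Real.cos t ∧ Real.sin s = Real.sin t := by
  constructor
  · have := congrArg Complex.re h
    rwa [Complex.exp_ofReal_mul_I_re, Complex.exp_ofReal_mul_I_re] at this
  · have := congrArg Complex.im h
    rwa [Complex.exp_ofReal_mul_I_im, Complex.exp_ofReal_mul_I_im] at this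

theorem Phi_comm (α β : ℝ) : Phi α β = Phi β α := by
  unfold Phi; rw [add_comm β α, add_comm (Real.cos β), add_comm (Real.sin β)]

theorem crit_ne1 {α β : ℝ} (h : IsCrit (Phi α β)) :
    Complex.exp (α * I) ≠ Complex.exp (β * I) := by
  intro he
  obtain ⟨hc, hs⟩ := exp_eq_imp he
  apply not_crit_tan α 2 (by norm_num)
  convert h using 1
  unfold Phi
  rw [Real.cos_add, Real.sin_add, ← hc, ← hs, Real.cos_two_mul', Real.sin_two_mul]
  ext <;> simp only <;> ring

theorem crit_ne2 {α β : ℝ} (h : IsCrit (Phi α β)) :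
    Complex.exp (α * I) ≠ Complex.exp ((-(α+β) : ℝ) * I) := by
  intro he
  obtain ⟨hc, hs⟩ := exp_eq_imp he
  rw [Real.cos_neg] at hc
  rw [Real.sin_neg] at hs
  apply not_crit_tan α 2 (by norm_num)
  convert h using 1
  have hb : β = (α + β) - α := by ring
  have h1 : Real.cos β = Real.cos (2*α) := by
    rw [hb, Real.cos_sub, ← hc, Real.cos_two_mul']
    linear_combination (Real.sin α) * hs
  have h2 : Real.sin β = -Real.sin (2*α) := by
    rw [hb, Real.sin_sub, ← hc, Real.sin_two_mul]
    linear_combination (Real.cos α) * hs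
  unfold Phi
  rw [← hc, h1, h2]
  ext
  · simp only; ring
  · simp only; linear_combination hs

theorem crit_ne3 {α β : ℝ} (h : IsCrit (Phi α β)) :
    Complex.exp (β * I) ≠ Complex.exp ((-(α+β) : ℝ) * I) := by
  rw [add_comm]; exact crit_ne2 (Phi_comm α β ▸ h)

theorem crit_torus {p : ℝ × ℝ} (h : IsCrit p) : ∃ α β, p = Phi α β := by
  obtain ⟨x, y⟩ := p
  obtain ⟨β, t, rfl, rfl⟩ := exists_tan x y
  have ht : t^2 < 4 := by
    by_contra hc
    exact not_crit_tan β t (not_lt.mp hc) h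
  have h1 : -1 ≤ t/2 := by nlinarith
  have h2 : t/2 ≤ 1 := by nlinarith
  have h3 := Real.cos_arccos h1 h2
  set d := Real.arccos (t/2)
  have h4 : t = 2 * Real.cos d := by linarith
  refine ⟨β + d, β - d, ?_⟩
  unfold Phi
  rw [h4, Real.cos_add β d, Real.cos_sub β d, Real.sin_add β d, Real.sin_sub β d,
    show β + d + (β - d) = 2 * β by ring]
  ext <;> simp only <;> ring

/-- primitive root of order 90 of unity -/
def xi : ℂ := Complex.exp (2 * Real.pi * I / 90)

theorem xi_prim : IsPrimitiveRoot xi 90 := by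
  have := Complex.isPrimitiveRoot_exp 90 (by norm_num)
  unfold xi; exact_mod_cast this

theorem omega_eq : Complex.exp (th * I) = xi ^ 30 := by
  unfold xi th; rw [← Complex.exp_nat_mul]; congr 1; push_cast; ring

theorem xi_45 : xi ^ 45 = -1 := by
  unfold xi; rw [← Complex.exp_nat_mul, ← Complex.exp_pi_mul_I]; congr 1; push_cast; ring

theorem alg_cases {a b c : ℂ} (h : a * b * c = 1) (h1 : c - c⁻¹ = a - a⁻¹)
    (h2 : c - c⁻¹ = b - b⁻¹) :
    (a = b ∧ b = c ∧ a^3 = 1) ∨ (a = 1 ∧ b = -1 ∧ c = -1) ∨ (a = -1 ∧ b = 1 ∧ c = -1) ∨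
    (a = -1 ∧ b = -1 ∧ c = 1) := by
  have ha : a ≠ 0 := by rintro rfl; simp at h
  have hb : b ≠ 0 := by rintro rfl; simp at h
  have hc : c ≠ 0 := by rintro rfl; simp at h
  have k1 : (c - a) * (c * a + 1) = 0 := by field_simp at h1; linear_combination h1
  have k2 : (c - b) * (c * b + 1) = 0 := by field_simp at h2; linear_combination h2
  have k3 : ∀ {p q r : ℂ}, p * q * r = 1 → p * q + 1 = 0 → r = -1 := by
    intro p q r e1 e2
    linear_combination r * e2 - e1
  rcases mul_eq_zero.mp k1 with e1 | e1
  · have e1 : c = a := sub_eq_zero.mp e1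
    rcases mul_eq_zero.mp k2 with e2 | e2
    · have e2 : c = b := sub_eq_zero.mp e2
      left
      subst e1
      subst e2
      exact ⟨rfl, rfl, by linear_combination h⟩
    · have e3 : a = -1 := k3 (by linear_combination h) e2
      subst e1
      rw [e3] at h ⊢
      right; right; left
      refine ⟨rfl, by linear_combination h, rfl⟩
  · have e3 : b = -1 := k3 (by linear_combination h) e1
    rw [e3] at h k2 ⊢
    rcases mul_eq_zero.mp k2 with e2 | e2
    · have e4 : c = -1 := by linear_combination e2
      rw [e4] at h ⊢
      right; left
      exact ⟨by linear_combination h, rfl, rfl⟩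
    · have e4 : c = 1 := by linear_combination -e2
      rw [e4] at h ⊢
      right; right; right
      exact ⟨by linear_combination -h, rfl, rfl⟩

/-- The index condition, symmetric in the three exponents. -/
def Typ (l m n : ℕ) : Prop :=
  (l % 6 = m % 6 ∧ m % 6 = n % 6 ∧ l % 2 = 0) ∨ (l % 6 = 4 ∧ m % 6 = 1 ∧ n % 6 = 1) ∨
    (l % 6 = 1 ∧ m % 6 = 4 ∧ n % 6 = 1) ∨ (l % 6 = 1 ∧ m % 6 = 1 ∧ n % 6 = 4)

theorem necessary {α β : ℝ} (h : IsCrit (Phi α β)) : ∃ l m n : ℕ, l < 90 ∧ m < 90 ∧ n < 90 ∧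
    Complex.exp (α * I) = xi ^ l ∧ Complex.exp (β * I) = xi ^ m ∧
    Complex.exp ((-(α+β) : ℝ) * I) = xi ^ n ∧ (l + m + n) % 90 = 0 ∧ Typ l m n ∧
    l ≠ m ∧ l ≠ n ∧ m ≠ n := by
  have n1 := crit_ne1 h
  have n2 := crit_ne2 h
  have n3 := crit_ne3 h
  obtain ⟨s1, s2⟩ := sin_of_crit h
  have hw : ∀ s : ℝ, Complex.exp ((15*s + th : ℝ) * I) = xi^30 * Complex.exp (s * I)^15 := by
    intro s
    rw [← omega_eq, ← Complex.exp_nat_mul, ← Complex.exp_add]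
    congr 1; push_cast; ring
  have hs : ∀ s : ℝ, 2 * I * (Real.sin s : ℂ) = Complex.exp (s * I) - (Complex.exp (s * I))⁻¹ := by
    intro s
    rw [← Complex.exp_neg, ← neg_mul, Complex.ofReal_sin, Complex.sin]
    linear_combination ((Complex.exp (-s*I) - Complex.exp (s * I))) * Complex.I_sq
  have habc : Complex.exp (α * I) * Complex.exp (β * I) * Complex.exp ((-(α+β) : ℝ) * I) = 1 := by
    rw [← Complex.exp_add, ← Complex.exp_add, ← Complex.exp_zero]
    congr 1; push_cast; ring
  have t1 := hs (15*(-(α+β)) + th)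
  have t2 := hs (15*α + th)
  have t3 := hs (15*β + th)
  rw [hw] at t1 t2 t3
  rw [s1] at t1
  rw [← s2, s1] at t3
  have h90 : xi^90 = 1 := xi_prim.pow_eq_one
  set a := Complex.exp (α * I)
  set b := Complex.exp (β * I)
  set c := Complex.exp ((-(α+β) : ℝ) * I)
  have hcases := alg_cases (a := xi^30 * a^15) (b := xi^30 * b^15) (c := xi^30 * c^15)
    (by
      have : (xi^30 * a^15) * (xi^30 * b^15) * (xi^30 * c^15) = xi^90 * (a*b*c)^15 := by ring
      rw [this, h90, habc]; norm_num) (t1.symm.trans t2) (t1.symm.trans t3)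
  have root : ∀ z : ℂ, (xi^30 * z^15)^6 = 1 → ∃ l < 90, xi^l = z := by
    intro z hz
    apply xi_prim.eq_pow_of_pow_eq_one
    have : (xi^30 * z^15)^6 = (xi^90)^2 * z^90 := by ring
    rw [this, h90] at hz
    linear_combination hz
  have h6 : (xi^30 * a^15)^6 = 1 ∧ (xi^30 * b^15)^6 = 1 ∧ (xi^30 * c^15)^6 = 1 := by
    have cube : ∀ z : ℂ, z^3 = 1 → z^6 = 1 := fun z hz => by
      rw [show z^6 = (z^3)^2 by ring, hz]; norm_num
    rcases hcases with ⟨e1, e2, e3⟩ | ⟨e1, e2, e3⟩ | ⟨e1, e2, e3⟩ | ⟨e1, e2, e3⟩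
    · rw [← e2, ← e1]; exact ⟨cube _ e3, cube _ e3, cube _ e3⟩
    all_goals rw [e1, e2, e3]; norm_num
  obtain ⟨l, hl, el⟩ := root a h6.1
  obtain ⟨m, hm, em⟩ := root b h6.2.1
  obtain ⟨n, hn, en⟩ := root c h6.2.2
  rw [← el, ← em] at n1
  rw [← el, ← en] at n2
  rw [← em, ← en] at n3
  rw [← el, ← em, ← en] at habc hcases
  refine ⟨l, m, n, hl, hm, hn, el.symm, em.symm, en.symm, ?_, ?_, ?_, ?_, ?_⟩
  · rw [← pow_add, ← pow_add] at habc
    exact Nat.mod_eq_zero_of_dvd ((xi_prim.pow_eq_one_iff_dvd _).mp habc)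
  · have q : ∀ k : ℕ, xi^30 * (xi^k)^15 = xi^(30 + 15 * k) := fun k => by
      rw [← pow_mul, ← pow_add]; congr 1; ring
    rw [q, q, q] at hcases
    have r1 : ∀ k : ℕ, xi^(30 + 15 * k) = 1 → k % 6 = 4 := fun k hk => by
      have := (xi_prim.pow_eq_one_iff_dvd _).mp hk; omega
    have r2 : ∀ k : ℕ, xi^(30 + 15 * k) = -1 → k % 6 = 1 := fun k hk => by
      have hk' : xi^(30 + 15 * k + 45) = 1 := by rw [pow_add, hk, xi_45]; norm_num
      have := (xi_prim.pow_eq_one_iff_dvd _).mp hk'; omega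
    have r3 : ∀ k : ℕ, (xi^(30 + 15 * k))^3 = 1 → k % 2 = 0 := fun k hk => by
      rw [← pow_mul] at hk
      have := (xi_prim.pow_eq_one_iff_dvd _).mp hk; omega
    have r4 : ∀ k k' : ℕ, xi^(30 + 15 * k) = xi^(30 + 15 * k') → k % 6 = k' % 6 := fun k k' hk => by
      have h3 : xi^(30 + 15 * k + 15 * 5 * k' + 60) = 1 := by
        have h4 : xi^(30 + 15 * k + 15 * 5 * k' + 60) = xi^(30 + 15 * k) * xi^(15*5*k' + 60) := by
          rw [← pow_add]; congr 1
        rw [h4, hk, ← pow_add]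
        apply (xi_prim.pow_eq_one_iff_dvd _).mpr
        omega
      have := (xi_prim.pow_eq_one_iff_dvd _).mp h3; omega
    rcases hcases with ⟨e1, e2, e3⟩ | ⟨e1, e2, e3⟩ | ⟨e1, e2, e3⟩ | ⟨e1, e2, e3⟩
    · exact Or.inl ⟨r4 _ _ e1, r4 _ _ e2, r3 _ e3⟩
    · exact Or.inr (Or.inl ⟨r1 _ e1, r2 _ e2, r2 _ e3⟩)
    · exact Or.inr (Or.inr (Or.inl ⟨r2 _ e1, r1 _ e2, r2 _ e3⟩))
    · exact Or.inr (Or.inr (Or.inr ⟨r2 _ e1, r2 _ e2, r1 _ e3⟩))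
  · rintro rfl; exact n1 rfl
  · rintro rfl; exact n2 rfl
  · rintro rfl; exact n3 rfl

end Nodes

namespace Nodes
open Complex (I)
open scoped ContDiff

def ang (m : ℕ) : ℝ := 2 * Real.pi * m / 90

theorem exp_ang (m : ℕ) : Complex.exp (ang m * I) = xi ^ m := by
  unfold ang xi; rw [← Complex.exp_nat_mul]; congr 1; push_cast; ring

theorem ang_sum {l m n : ℕ} (h : (l + m + n) % 90 = 0) :
    ∃ q : ℕ, -(ang l + ang m) = ang n - q * (2 * Real.pi) := by
  obtain ⟨q, hq⟩ := Nat.dvd_of_mod_eq_zero h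
  have : (l : ℝ) + m + n = 90 * q := by exact_mod_cast hq
  exact ⟨q, by unfold ang; linear_combination (-2 * Real.pi / 90) * this⟩

theorem exp_ang3 {l m n : ℕ} (h : (l + m + n) % 90 = 0) :
    Complex.exp ((-(ang l + ang m) : ℝ) * I) = xi ^ n := by
  have h2 : Complex.exp (ang l * I) * Complex.exp (ang m * I)
      * Complex.exp ((-(ang l + ang m) : ℝ) * I) = 1 := by
    rw [← Complex.exp_add, ← Complex.exp_add, ← Complex.exp_zero]
    congr 1; push_cast; ring
  have h3 : xi^l * xi^m * xi^n = 1 := by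
    rw [← pow_add, ← pow_add]
    exact (xi_prim.pow_eq_one_iff_dvd _).mpr (Nat.dvd_of_mod_eq_zero h)
  rw [exp_ang, exp_ang] at h2
  have hne : xi^l * xi^m ≠ 0 := left_ne_zero_of_mul_eq_one h3
  exact mul_left_cancel₀ hne (h2.trans h3.symm)

theorem trig3 {l m n : ℕ} (h : (l + m + n) % 90 = 0) :
    Real.cos (15 * (-(ang l + ang m)) + th) = Real.cos (15 * ang n + th) ∧
    Real.sin (15 * (-(ang l + ang m)) + th) = Real.sin (15 * ang n + th) := by
  obtain ⟨q, hq⟩ := ang_sum h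
  have e : 15 * (-(ang l + ang m)) + th = 15 * ang n + th - (15 * q : ℕ) * (2 * Real.pi) := by
    rw [hq]; push_cast; ring
  rw [e, Real.cos_sub_nat_mul_two_pi, Real.sin_sub_nat_mul_two_pi]
  exact ⟨rfl, rfl⟩

theorem trig_red (m r : ℕ) (h : m % 6 = r) :
    Real.cos (15 * ang m + th) = Real.cos ((r + 2) * Real.pi / 3) ∧
    Real.sin (15 * ang m + th) = Real.sin ((r + 2) * Real.pi / 3) := by
  obtain ⟨q, hq⟩ : ∃ q, m = 6 * q + r := ⟨m / 6, by omega⟩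
  have hq' : (m : ℝ) = 6 * q + r := by exact_mod_cast hq
  have e : 15 * ang m + th = (r + 2) * Real.pi / 3 + q * (2 * Real.pi) := by
    unfold ang th; rw [hq']; ring
  rw [e, Real.cos_add_nat_mul_two_pi, Real.sin_add_nat_mul_two_pi]
  exact ⟨rfl, rfl⟩

theorem trig_4 {m : ℕ} (h : m % 6 = 4) :
    Real.cos (15 * ang m + th) = 1 ∧ Real.sin (15 * ang m + th) = 0 := by
  obtain ⟨h1, h2⟩ := trig_red m 4 h
  rw [h1, h2, show ((4 : ℕ) + 2 : ℝ) * Real.pi / 3 = 2 * Real.pi by push_cast; ring]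
  exact ⟨Real.cos_two_pi, Real.sin_two_pi⟩

theorem trig_1 {m : ℕ} (h : m % 6 = 1) :
    Real.cos (15 * ang m + th) = -1 ∧ Real.sin (15 * ang m + th) = 0 := by
  obtain ⟨h1, h2⟩ := trig_red m 1 h
  rw [h1, h2, show ((1 : ℕ) + 2 : ℝ) * Real.pi / 3 = Real.pi by push_cast; ring]
  exact ⟨Real.cos_pi, Real.sin_pi⟩

theorem trig_0 {m : ℕ} (h : m % 6 = 0 ∨ m % 6 = 2) : Real.cos (15 * ang m + th) = -1/2 := by
  rcases h with h | h
  · rw [(trig_red m 0 h).1, show ((0 : ℕ) + 2 : ℝ) * Real.pi / 3 = Real.pi - Real.pi / 3 by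
      push_cast; ring, Real.cos_pi_sub, Real.cos_pi_div_three]; norm_num
  · rw [(trig_red m 2 h).1, show ((2 : ℕ) + 2 : ℝ) * Real.pi / 3 = Real.pi / 3 + Real.pi by
      push_cast; ring, Real.cos_add_pi, Real.cos_pi_div_three]; norm_num

theorem xi_ne {l m : ℕ} (hl : l < 90) (hm : m < 90) (h : l ≠ m) : xi^l ≠ xi^m :=
  fun e => h (xi_prim.pow_inj hl hm e)

theorem F_ang {l m n : ℕ} (h : (l + m + n) % 90 = 0) :
    F (Phi (ang l) (ang m)) = 2 + 2 * (Real.cos (15 * ang l + th) + Real.cos (15 * ang m + th)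
      + Real.cos (15 * ang n + th)) := by
  rw [F_Phi, (trig3 h).1]

theorem suff {l m n : ℕ} (hl : l < 90) (hm : m < 90) (hn : n < 90) (h : (l + m + n) % 90 = 0)
    (h1 : l ≠ m) (h2 : l ≠ n) (h3 : m ≠ n) (ht : Typ l m n) :
    IsCrit (Phi (ang l) (ang m)) ∧ hdet (Phi (ang l) (ang m)) ≠ 0 := by
  obtain ⟨t1, t2⟩ := trig3 h
  have hD : Dt (ang l) (ang m) ≠ 0 := by
    apply Dt_ne <;> simp only [exp_ang3 h, exp_ang]
    · exact xi_ne hl hm h1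
    · exact xi_ne hl hn h2
    · exact xi_ne hm hn h3
  have hs : Real.sin (15 * ang n + th) = Real.sin (15 * ang l + th) ∧
      Real.sin (15 * ang n + th) = Real.sin (15 * ang m + th) := by
    rcases ht with ⟨e1, e2, e3⟩ | ⟨e1, e2, e3⟩ | ⟨e1, e2, e3⟩ | ⟨e1, e2, e3⟩
    · rw [(trig_red l _ rfl).2, (trig_red m _ rfl).2, (trig_red n _ rfl).2, e1, e2]
      exact ⟨rfl, rfl⟩
    · rw [(trig_4 e1).2, (trig_1 e2).2, (trig_1 e3).2]; exact ⟨rfl, rfl⟩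
    · rw [(trig_1 e1).2, (trig_4 e2).2, (trig_1 e3).2]; exact ⟨rfl, rfl⟩
    · rw [(trig_1 e1).2, (trig_1 e2).2, (trig_4 e3).2]; exact ⟨rfl, rfl⟩
  have hcr : IsCrit (Phi (ang l) (ang m)) := by
    apply crit_of_sin hD
    · rw [t2, hs.1]
    · rw [t2, hs.2]
  refine ⟨hcr, hdet_ne hcr ?_⟩
  rw [t1]
  rcases ht with ⟨e1, e2, e3⟩ | ⟨e1, e2, e3⟩ | ⟨e1, e2, e3⟩ | ⟨e1, e2, e3⟩
  · have : l % 6 = 4 ∨ (l % 6 = 0 ∨ l % 6 = 2) := by omega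
    rcases this with g | g
    · rw [(trig_4 g).1, (trig_4 (e1 ▸ g)).1, (trig_4 (e2 ▸ e1 ▸ g)).1]; norm_num
    · rw [trig_0 g, trig_0 (e1 ▸ g), trig_0 (e2 ▸ e1 ▸ g)]; norm_num
  · rw [(trig_4 e1).1, (trig_1 e2).1, (trig_1 e3).1]; norm_num
  · rw [(trig_1 e1).1, (trig_4 e2).1, (trig_1 e3).1]; norm_num
  · rw [(trig_1 e1).1, (trig_1 e2).1, (trig_4 e3).1]; norm_num

/-- the third exponent -/
def m3 (k : ℕ × ℕ) : ℕ := (180 - k.1 - k.2) % 90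

def I8 : Finset (ℕ × ℕ) := (Finset.range 90 ×ˢ Finset.range 90).filter fun k =>
  k.1 < k.2 ∧ k.2 < m3 k ∧ k.1 % 6 = 4 ∧ k.2 % 6 = 4 ∧ m3 k % 6 = 4

def I1 : Finset (ℕ × ℕ) := (Finset.range 90 ×ˢ Finset.range 90).filter fun k =>
  k.1 < k.2 ∧ k.2 < m3 k ∧ ((k.1 % 6 = 0 ∧ k.2 % 6 = 0 ∧ m3 k % 6 = 0) ∨
    (k.1 % 6 = 2 ∧ k.2 % 6 = 2 ∧ m3 k % 6 = 2))

def I0 : Finset (ℕ × ℕ) := (Finset.range 90 ×ˢ Finset.range 90).filter fun k =>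
  k.1 < k.2 ∧ k.2 < m3 k ∧ ((k.1 % 6 = 4 ∧ k.2 % 6 = 1 ∧ m3 k % 6 = 1) ∨
    (k.1 % 6 = 1 ∧ k.2 % 6 = 4 ∧ m3 k % 6 = 1) ∨ (k.1 % 6 = 1 ∧ k.2 % 6 = 1 ∧ m3 k % 6 = 4))

theorem card_I8 : I8.card = 30 := by decide +kernel
theorem card_I1 : I1.card = 61 := by decide +kernel
theorem card_I0 : I0.card = 105 := by decide +kernel

def Good (k : ℕ × ℕ) : Prop :=
  k.1 < 90 ∧ k.2 < 90 ∧ k.1 < k.2 ∧ k.2 < m3 k ∧ Typ k.1 k.2 (m3 k)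

theorem mem_I8 (k : ℕ × ℕ) : k ∈ I8 ↔ (k.1 < 90 ∧ k.2 < 90) ∧
    k.1 < k.2 ∧ k.2 < m3 k ∧ k.1 % 6 = 4 ∧ k.2 % 6 = 4 ∧ m3 k % 6 = 4 := by
  rw [I8, Finset.mem_filter, Finset.mem_product, Finset.mem_range, Finset.mem_range]

theorem mem_I1 (k : ℕ × ℕ) : k ∈ I1 ↔ (k.1 < 90 ∧ k.2 < 90) ∧
    k.1 < k.2 ∧ k.2 < m3 k ∧ ((k.1 % 6 = 0 ∧ k.2 % 6 = 0 ∧ m3 k % 6 = 0) ∨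
    (k.1 % 6 = 2 ∧ k.2 % 6 = 2 ∧ m3 k % 6 = 2)) := by
  rw [I1, Finset.mem_filter, Finset.mem_product, Finset.mem_range, Finset.mem_range]

theorem mem_I0 (k : ℕ × ℕ) : k ∈ I0 ↔ (k.1 < 90 ∧ k.2 < 90) ∧
    k.1 < k.2 ∧ k.2 < m3 k ∧ ((k.1 % 6 = 4 ∧ k.2 % 6 = 1 ∧ m3 k % 6 = 1) ∨
    (k.1 % 6 = 1 ∧ k.2 % 6 = 4 ∧ m3 k % 6 = 1) ∨
    (k.1 % 6 = 1 ∧ k.2 % 6 = 1 ∧ m3 k % 6 = 4)) := by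
  rw [I0, Finset.mem_filter, Finset.mem_product, Finset.mem_range, Finset.mem_range]

attribute [irreducible] I8 I1 I0

theorem typ_iff (a b c : ℕ) : Typ a b c ↔ (a % 6 = 4 ∧ b % 6 = 4 ∧ c % 6 = 4) ∨
    ((a % 6 = 0 ∧ b % 6 = 0 ∧ c % 6 = 0) ∨ (a % 6 = 2 ∧ b % 6 = 2 ∧ c % 6 = 2)) ∨
    ((a % 6 = 4 ∧ b % 6 = 1 ∧ c % 6 = 1) ∨ (a % 6 = 1 ∧ b % 6 = 4 ∧ c % 6 = 1) ∨
    (a % 6 = 1 ∧ b % 6 = 1 ∧ c % 6 = 4)) := by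
  unfold Typ
  have ha : a % 6 < 6 := Nat.mod_lt _ (by norm_num)
  have hb : b % 6 < 6 := Nat.mod_lt _ (by norm_num)
  have hc : c % 6 < 6 := Nat.mod_lt _ (by norm_num)
  have e2 : a % 2 = a % 6 % 2 := by omega
  try rw [e2]
  generalize a % 6 = x at *
  generalize b % 6 = y at *
  generalize c % 6 = z at *
  clear e2
  interval_cases x <;> interval_cases y <;> interval_cases z <;> simp

theorem distr (A B C D P Q R : Prop) : (A ∧ B ∧ C ∧ D ∧ (P ∨ Q ∨ R)) ↔
    ((A ∧ B) ∧ C ∧ D ∧ P) ∨ ((A ∧ B) ∧ C ∧ D ∧ Q) ∨ ((A ∧ B) ∧ C ∧ D ∧ R) := by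
  tauto

theorem good_iff (k : ℕ × ℕ) : Good k ↔ k ∈ I8 ∨ k ∈ I1 ∨ k ∈ I0 := by
  rw [mem_I8, mem_I1, mem_I0, Good, typ_iff]
  exact distr _ _ _ _ _ _ _

theorem typ_swap {a b c : ℕ} (h : Typ a b c) : Typ b a c := by
  rw [typ_iff] at h ⊢; tauto

theorem typ_swap' {a b c : ℕ} (h : Typ a b c) : Typ a c b := by
  rw [typ_iff] at h ⊢; tauto

theorem m3_lt (k : ℕ × ℕ) : m3 k < 90 := Nat.mod_lt _ (by norm_num)

theorem m3_sum {k : ℕ × ℕ} (h : Good k) : (k.1 + k.2 + m3 k) % 90 = 0 := by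
  have h1 := h.1
  have h2 := h.2.1
  unfold m3; omega

def pt (k : ℕ × ℕ) : ℝ × ℝ := Phi (ang k.1) (ang k.2)

theorem good_crit {k : ℕ × ℕ} (h : Good k) : IsCrit (pt k) ∧ hdet (pt k) ≠ 0 := by
  have hs := m3_sum h
  obtain ⟨h1, h2, h3, h4, h5⟩ := h
  exact suff h1 h2 (m3_lt k) hs (by omega) (by omega) (by omega) h5

theorem F_I8 {k : ℕ × ℕ} (h : k ∈ I8) : F (pt k) = 8 := by
  have hs := m3_sum ((good_iff k).mpr (Or.inl h))
  rw [mem_I8] at h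
  obtain ⟨-, -, -, a, b, c⟩ := h
  rw [pt, F_ang hs, (trig_4 a).1, (trig_4 b).1, (trig_4 c).1]; norm_num

theorem F_I1 {k : ℕ × ℕ} (h : k ∈ I1) : F (pt k) = -1 := by
  have hs := m3_sum ((good_iff k).mpr (Or.inr (Or.inl h)))
  rw [mem_I1] at h
  obtain ⟨-, -, -, h⟩ := h
  rw [pt, F_ang hs, trig_0 (by omega), trig_0 (by omega), trig_0 (by omega)]; norm_num

theorem F_I0 {k : ℕ × ℕ} (h : k ∈ I0) : F (pt k) = 0 := by
  have hs := m3_sum ((good_iff k).mpr (Or.inr (Or.inr h)))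
  rw [mem_I0] at h
  obtain ⟨-, -, -, h⟩ := h
  rw [pt, F_ang hs]
  rcases h with ⟨a, b, c⟩ | ⟨a, b, c⟩ | ⟨a, b, c⟩
  · rw [(trig_4 a).1, (trig_1 b).1, (trig_1 c).1]; norm_num
  · rw [(trig_1 a).1, (trig_4 b).1, (trig_1 c).1]; norm_num
  · rw [(trig_1 a).1, (trig_1 b).1, (trig_4 c).1]; norm_num

/-- the complex coordinate of a point of the plane -/
def cx (p : ℝ × ℝ) : ℂ := p.1 + p.2 * I

theorem cx_inj {p q : ℝ × ℝ} (h : cx p = cx q) : p = q := by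
  have h1 := congrArg Complex.re h
  have h2 := congrArg Complex.im h
  simp [cx] at h1 h2
  exact Prod.ext h1 h2

theorem cx_Phi (α β : ℝ) : cx (Phi α β) =
    Complex.exp (α * I) + Complex.exp (β * I) + Complex.exp ((-(α+β) : ℝ) * I) := by
  rw [Complex.exp_mul_I, Complex.exp_mul_I, Complex.exp_mul_I, ← Complex.ofReal_cos,
    ← Complex.ofReal_cos, ← Complex.ofReal_cos, ← Complex.ofReal_sin, ← Complex.ofReal_sin,
    ← Complex.ofReal_sin, Real.cos_neg, Real.sin_neg, cx, Phi]
  push_cast; ring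

theorem cx_pt {k : ℕ × ℕ} (h : Good k) : cx (pt k) = xi^k.1 + xi^k.2 + xi^(m3 k) := by
  rw [pt, cx_Phi, exp_ang, exp_ang, exp_ang3 (m3_sum h)]

theorem crit_exists {p : ℝ × ℝ} (h : IsCrit p) : ∃ k, Good k ∧ pt k = p := by
  obtain ⟨α, β, rfl⟩ := crit_torus h
  obtain ⟨l, m, n, hl, hm, hn, el, em, en, hs, ht, h1, h2, h3⟩ := necessary h
  have hcx := cx_Phi α β
  rw [el, em, en] at hcx
  have main : ∀ a b c : ℕ, a < b → b < c → c < 90 → (a + b + c) % 90 = 0 → Typ a b c →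
      xi^a + xi^b + xi^c = xi^l + xi^m + xi^n → ∃ k, Good k ∧ pt k = Phi α β := by
    intro a b c hab hbc hc hs ht he
    have hm3 : m3 (a, b) = c := by simp only [m3]; omega
    have hg : Good (a, b) := ⟨(hab.trans hbc).trans hc, hbc.trans hc, hab, by rw [hm3]; exact hbc,
      by rw [hm3]; exact ht⟩
    refine ⟨(a, b), hg, cx_inj ?_⟩
    rw [cx_pt hg, hcx, hm3, he]
  rcases lt_or_gt_of_ne h1 with o1 | o1 <;> rcases lt_or_gt_of_ne h2 with o2 | o2 <;>
    rcases lt_or_gt_of_ne h3 with o3 | o3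
  · exact main l m n o1 o3 hn hs ht rfl
  · exact main l n m o2 o3 hm (by omega) (typ_swap' ht) (by ring)
  · omega
  · exact main n l m o2 o1 hm (by omega) (typ_swap (typ_swap' ht)) (by ring)
  · exact main m l n o1 o2 hn (by omega) (typ_swap ht) (by ring)
  · omega
  · exact main m n l o3 o2 hl (by omega) (typ_swap' (typ_swap ht)) (by ring)
  · exact main n m l o3 o1 hl (by omega) (typ_swap (typ_swap' (typ_swap ht))) (by ring)

theorem pt_inj {k k' : ℕ × ℕ} (h : Good k) (h' : Good k') (e : pt k = pt k') : k = k' := by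
  have e1 := congrArg cx e
  rw [cx_pt h, cx_pt h'] at e1
  have hnorm : ∀ m : ℕ, (starRingEnd ℂ) (xi^m) * xi^m = 1 := by
    intro m
    rw [← exp_ang, ← Complex.exp_conj, ← Complex.exp_add, ← Complex.exp_zero]
    congr 1
    rw [map_mul, Complex.conj_I, Complex.conj_ofReal]; ring
  have prod : ∀ {k : ℕ × ℕ}, Good k → xi^k.1 * xi^k.2 * xi^(m3 k) = 1 := by
    intro k hk
    rw [← pow_add, ← pow_add]
    exact (xi_prim.pow_eq_one_iff_dvd _).mpr (Nat.dvd_of_mod_eq_zero (m3_sum hk))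
  have e2 := congrArg (starRingEnd ℂ) e1
  simp only [map_add] at e2
  have sym2 : ∀ {a b c a' b' c' : ℂ}, a' * a = 1 → b' * b = 1 → c' * c = 1 → a * b * c = 1 →
      a' + b' + c' = b * c + a * c + a * b := by
    intro a b c a' b' c' ha hb hc h
    linear_combination (b*c)*ha - a'*h + (a*c)*hb - b'*h + (a*b)*hc - c'*h
  have p1 := prod h
  have p2 := prod h'
  rw [sym2 (hnorm _) (hnorm _) (hnorm _) p1, sym2 (hnorm _) (hnorm _) (hnorm _) p2] at e2
  obtain ⟨h1, h2, h3, h4, -⟩ := h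
  obtain ⟨h1', h2', h3', h4', -⟩ := h'
  have h5 := m3_lt k
  have h5' := m3_lt k'
  have mem : ∀ {a b c z a' b' c' : ℂ}, a + b + c = a' + b' + c' →
      b*c + a*c + a*b = b'*c' + a'*c' + a'*b' → a*b*c = 1 → a'*b'*c' = 1 →
      (z = a ∨ z = b ∨ z = c) → z = a' ∨ z = b' ∨ z = c' := by
    intro a b c z a' b' c' q1 q2 q3 q4 hz
    have z0 : (z - a) * (z - b) * (z - c) = 0 := by
      rcases hz with rfl | rfl | rfl <;> ring
    have z1 : (z - a') * (z - b') * (z - c') = 0 := by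
      linear_combination z0 + z^2 * q1 - z * q2 + q3 - q4
    rcases mul_eq_zero.mp z1 with z2 | z2
    · rcases mul_eq_zero.mp z2 with z3 | z3
      · exact Or.inl (sub_eq_zero.mp z3)
      · exact Or.inr (Or.inl (sub_eq_zero.mp z3))
    · exact Or.inr (Or.inr (sub_eq_zero.mp z2))
  have conv : ∀ x : ℕ, x < 90 → (xi^x = xi^k'.1 ∨ xi^x = xi^k'.2 ∨ xi^x = xi^(m3 k')) →
      x = k'.1 ∨ x = k'.2 ∨ x = m3 k' := by
    intro x hx hh
    rcases hh with g | g | g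
    · exact Or.inl (xi_prim.pow_inj hx h1' g)
    · exact Or.inr (Or.inl (xi_prim.pow_inj hx h2' g))
    · exact Or.inr (Or.inr (xi_prim.pow_inj hx h5' g))
  have g1 := conv _ h1 (mem e1 e2 p1 p2 (Or.inl rfl))
  have g2 := conv _ h2 (mem e1 e2 p1 p2 (Or.inr (Or.inl rfl)))
  have g3 := conv _ h5 (mem e1 e2 p1 p2 (Or.inr (Or.inr rfl)))
  ext <;> omega

/-- index set of the nodes of the threefold -/
def K : Finset ((ℕ × ℕ) × (ℕ × ℕ)) := I8 ×ˢ I8 ∪ (I1 ×ˢ I1 ∪ I0 ×ˢ I0)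

theorem card_K : K.card = 15646 := by
  have d1 : Disjoint I1 I0 := by
    rw [Finset.disjoint_left]; intro k h1 h2
    have := F_I1 h1; have := F_I0 h2; linarith
  have d2 : Disjoint I8 I1 := by
    rw [Finset.disjoint_left]; intro k h1 h2
    have := F_I8 h1; have := F_I1 h2; linarith
  have d3 : Disjoint I8 I0 := by
    rw [Finset.disjoint_left]; intro k h1 h2
    have := F_I8 h1; have := F_I0 h2; linarith
  unfold K
  rw [Finset.card_union_of_disjoint, Finset.card_union_of_disjoint, Finset.card_product,
    Finset.card_product, Finset.card_product, card_I8, card_I1, card_I0]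
  · exact Finset.disjoint_product.mpr (Or.inl d1)
  · exact Finset.disjoint_union_right.mpr ⟨Finset.disjoint_product.mpr (Or.inl d2),
      Finset.disjoint_product.mpr (Or.inl d3)⟩

theorem mem_K (k l : ℕ × ℕ) : (k, l) ∈ K ↔ Good k ∧ Good l ∧ F (pt k) = F (pt l) := by
  simp only [K, Finset.mem_union, Finset.mem_product]
  constructor
  · rintro (⟨h1, h2⟩ | ⟨h1, h2⟩ | ⟨h1, h2⟩)
    · exact ⟨(good_iff k).mpr (Or.inl h1), (good_iff l).mpr (Or.inl h2), by
        rw [F_I8 h1, F_I8 h2]⟩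
    · exact ⟨(good_iff k).mpr (Or.inr (Or.inl h1)), (good_iff l).mpr (Or.inr (Or.inl h2)), by
        rw [F_I1 h1, F_I1 h2]⟩
    · exact ⟨(good_iff k).mpr (Or.inr (Or.inr h1)), (good_iff l).mpr (Or.inr (Or.inr h2)), by
        rw [F_I0 h1, F_I0 h2]⟩
  · rintro ⟨h1, h2, h3⟩
    rcases (good_iff k).mp h1 with a | a | a <;> rcases (good_iff l).mp h2 with b | b | b
    · exact Or.inl ⟨a, b⟩
    · rw [F_I8 a, F_I1 b] at h3; norm_num at h3
    · rw [F_I8 a, F_I0 b] at h3; norm_num at h3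
    · rw [F_I1 a, F_I8 b] at h3; norm_num at h3
    · exact Or.inr (Or.inl ⟨a, b⟩)
    · rw [F_I1 a, F_I0 b] at h3; norm_num at h3
    · rw [F_I0 a, F_I8 b] at h3; norm_num at h3
    · rw [F_I0 a, F_I1 b] at h3; norm_num at h3
    · exact Or.inr (Or.inr ⟨a, b⟩)

/-- the node with given index -/
def node (k : (ℕ × ℕ) × (ℕ × ℕ)) : Fin 4 → ℝ := ![(pt k.1).1, (pt k.1).2, (pt k.2).1, (pt k.2).2]

end Nodes

/-- The affine three-fold `J15(x₀,x₁) - J15(x₂,x₃) = 0` in `ℝ⁴` has exactly 15646 real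
singular points, all of them nodes (the Hessian is invertible there). -/
theorem stmt (f : (Fin 4 → ℝ) → ℝ)
    (hf : ∀ p, f p = J15R (p 0) (p 1) - J15R (p 2) (p 3)) :
    {p : Fin 4 → ℝ | f p = 0 ∧ ∀ i, pd i f p = 0}.Finite ∧
    {p : Fin 4 → ℝ | f p = 0 ∧ ∀ i, pd i f p = 0}.ncard = 15646 ∧
    ∀ p : Fin 4 → ℝ, f p = 0 → (∀ i, pd i f p = 0) → (hessian f p).det ≠ 0 := by
  have hset : {p : Fin 4 → ℝ | f p = 0 ∧ ∀ i, pd i f p = 0} = Set.image Nodes.node (Nodes.K : Set _) := by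
    ext p
    rw [Set.mem_ofPred_eq, Nodes.crit_iff f hf p]
    constructor
    · rintro ⟨h0, h1, h2⟩
      obtain ⟨k, hk, ek⟩ := Nodes.crit_exists h1
      obtain ⟨l, hl, el⟩ := Nodes.crit_exists h2
      refine ⟨(k, l), ?_, ?_⟩
      · rw [Finset.mem_coe, Nodes.mem_K]
        refine ⟨hk, hl, ?_⟩
        rw [ek, el]
        rw [hf] at h0
        simp only [Nodes.F]
        linarith
      · simp only [Nodes.node, ek, el]
        ext i
        fin_cases i <;> rfl
    · rintro ⟨⟨k, l⟩, hkl, rfl⟩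
      rw [Finset.mem_coe, Nodes.mem_K] at hkl
      obtain ⟨hk, hl, e⟩ := hkl
      refine ⟨?_, (Nodes.good_crit hk).1, (Nodes.good_crit hl).1⟩
      rw [hf]
      exact sub_eq_zero.mpr e
  have hinj : Set.InjOn Nodes.node (Nodes.K : Set _) := by
    rintro ⟨k, l⟩ h ⟨k', l'⟩ h' e
    rw [Finset.mem_coe, Nodes.mem_K] at h h'
    have e0 : (Nodes.pt k).1 = (Nodes.pt k').1 := congrFun e 0
    have e1 : (Nodes.pt k).2 = (Nodes.pt k').2 := congrFun e 1
    have e2 : (Nodes.pt l).1 = (Nodes.pt l').1 := congrFun e 2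
    have e3 : (Nodes.pt l).2 = (Nodes.pt l').2 := congrFun e 3
    rw [Nodes.pt_inj h.1 h'.1 (Prod.ext e0 e1), Nodes.pt_inj h.2.1 h'.2.1 (Prod.ext e2 e3)]
  refine ⟨?_, ?_, ?_⟩
  · rw [hset]; exact (Finset.finite_toSet _).image _
  · rw [hset, Set.ncard_image_of_injOn hinj, Set.ncard_coe_finset, Nodes.card_K]
  · intro p _ h
    rw [Nodes.crit_iff f hf p] at h
    rw [Nodes.det_hess f hf p]
    obtain ⟨k, hk, ek⟩ := Nodes.crit_exists h.1
    obtain ⟨l, hl, el⟩ := Nodes.crit_exists h.2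
    rw [← ek, ← el]
    exact mul_ne_zero (Nodes.good_crit hk).2 (Nodes.good_crit hl).2
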